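/- Let n ≥ 2, integers a, b ≥ 0 and 1 ≤ r ≤ n − 1. The ℂ-vector space 𝒳_{a,b,r} = {p ∈ 𝒫_{a,b,r} : ∂z̃ p = 0} has finite dimension x_{a,b,r} = (r/(a+r)) · C(n−1, r) · C(a+n−1, a) · C(b+n−2, b), where C(·,·) denotes the binomial coefficient. -/

import Mathlib

noncomputable section

/-- The negative definite quadratic form `-∑ vᵢ²` on `K^m`. -/
def negQ (K : Type) [Field K] (m : ℕ) : QuadraticForm K (Fin m → K) :=
  QuadraticMap.weightedSumSquares K (fun _ : Fin m => (-1 : K))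

/-- The complex Clifford algebra `ℂ_{2n}`, generated by `e_1, …, e_{2n}` with
`e_α e_β + e_β e_α = -2 δ_{αβ}`. -/
abbrev Cl (n : ℕ) : Type := CliffordAlgebra (negQ ℂ (n + n))

/-- The generators `e_α`, `α = 1, …, 2n`, of `ℂ_{2n}`. -/
def e (n : ℕ) (α : Fin (n + n)) : Cl n := CliffordAlgebra.ι (negQ ℂ (n + n)) (Pi.single α 1)

/-- The Witt basis element `𝔣_j = ½(e_j - i e_{n+j})`. -/
def ff (n : ℕ) (j : Fin n) : Cl n :=
  (2⁻¹ : ℂ) • (e n (Fin.castAdd n j) - Complex.I • e n (Fin.natAdd n j))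

/-- The Witt basis element `𝔣_j† = -½(e_j + i e_{n+j})`. -/
def ffd (n : ℕ) (j : Fin n) : Cl n :=
  -((2⁻¹ : ℂ) • (e n (Fin.castAdd n j) + Complex.I • e n (Fin.natAdd n j)))

/-- `f : ℂ^m → ℂ_{2n}` has directional derivative `d` at `z` in direction `v`
(componentwise, i.e. tested against all linear functionals on the finite-dimensional
space `ℂ_{2n}`; here `ℂ^m` is regarded as the real vector space `ℝ^{2m}`). -/
def HasDirDeriv {n m : ℕ} (f : (Fin m → ℂ) → Cl n) (z v : Fin m → ℂ) (d : Cl n) : Prop :=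
  ∀ φ : Cl n →ₗ[ℂ] ℂ, HasDerivAt (fun t : ℝ => φ (f (z + t • v))) (φ d) 0

/-- The directional derivative of `f` at `z` in direction `v` (junk value if none exists). -/
def dirDeriv {n m : ℕ} (f : (Fin m → ℂ) → Cl n) (v : Fin m → ℂ) (z : Fin m → ℂ) : Cl n :=
  letI : Nonempty (Cl n) := ⟨0⟩
  Classical.epsilon fun d => HasDirDeriv f z v d

/-- The Cauchy–Riemann operator `∂_{z_j} = ½(∂_{x_j} - i ∂_{y_j})`. -/
def pz {n m : ℕ} (j : Fin m) (f : (Fin m → ℂ) → Cl n) : (Fin m → ℂ) → Cl n := fun z =>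
  (2⁻¹ : ℂ) • (dirDeriv f (Pi.single j 1) z - Complex.I • dirDeriv f (Pi.single j Complex.I) z)

/-- The conjugate Cauchy–Riemann operator `∂_{z_j^c} = ½(∂_{x_j} + i ∂_{y_j})`. -/
def pzc {n m : ℕ} (j : Fin m) (f : (Fin m → ℂ) → Cl n) : (Fin m → ℂ) → Cl n := fun z =>
  (2⁻¹ : ℂ) • (dirDeriv f (Pi.single j 1) z + Complex.I • dirDeriv f (Pi.single j Complex.I) z)

/-- The Hermitean Dirac operator `∂_z g = ∑_j 𝔣_j† ∂_{z_j} g` on functions `ℂ^n → ℂ_{2n}`. -/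
def dzFull (n : ℕ) (g : (Fin n → ℂ) → Cl n) (z : Fin n → ℂ) : Cl n :=
  ∑ j : Fin n, ffd n j * pz j g z

/-- The Hermitean Dirac operator `∂_z† g = ∑_j 𝔣_j ∂_{z_j^c} g` on functions `ℂ^n → ℂ_{2n}`. -/
def dzdFull (n : ℕ) (g : (Fin n → ℂ) → Cl n) (z : Fin n → ℂ) : Cl n :=
  ∑ j : Fin n, ff n j * pzc j g z

/-- `g : ℂ^n → ℂ_{2n}` is Hermitean monogenic (everywhere). -/
def HMonogenic (n : ℕ) (g : (Fin n → ℂ) → Cl n) : Prop :=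
  ∀ z, dzFull n g z = 0 ∧ dzdFull n g z = 0

/-- The restricted Hermitean Dirac operator `∂_z̃ g = ∑_{j<n} 𝔣_j† ∂_{z_j} g` on functions
`ℂ^{n-1} → ℂ_{2n}`. -/
def dzT (n : ℕ) (g : (Fin (n - 1) → ℂ) → Cl n) (z : Fin (n - 1) → ℂ) : Cl n :=
  ∑ j : Fin (n - 1), ffd n (Fin.castLE (Nat.sub_le n 1) j) * pz j g z

/-- The restricted Hermitean Dirac operator `∂_z̃† g = ∑_{j<n} 𝔣_j ∂_{z_j^c} g` on functions
`ℂ^{n-1} → ℂ_{2n}`. -/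
def dzdT (n : ℕ) (g : (Fin (n - 1) → ℂ) → Cl n) (z : Fin (n - 1) → ℂ) : Cl n :=
  ∑ j : Fin (n - 1), ff n (Fin.castLE (Nat.sub_le n 1) j) * pzc j g z

/-- `p : ℂ^m → ℂ_{2n}` is a polynomial map (in the underlying real coordinates,
equivalently in `z_j` and their conjugates) with coefficients in `ℂ_{2n}`. -/
def IsPolyMap (n m : ℕ) (p : (Fin m → ℂ) → Cl n) : Prop :=
  ∃ (N : ℕ) (c : Fin N → Cl n) (dx dy : Fin N → Fin m → ℕ),
    ∀ z, p z = ∑ t, (∏ j, (z j) ^ dx t j * (starRingEnd ℂ) (z j) ^ dy t j) • c t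

/-- `p : ℂ^m → ℂ_{2n}` is a homogeneous polynomial of bidegree `(a, b)`:
it is polynomial and `p (c z) = c^a (conj c)^b p(z)`. -/
def IsBihom (n m a b : ℕ) (p : (Fin m → ℂ) → Cl n) : Prop :=
  IsPolyMap n m p ∧ ∀ (c : ℂ) (z : Fin m → ℂ),
    p (c • z) = (c ^ a * (starRingEnd ℂ) c ^ b) • p z

/-- The idempotent `I = (𝔣_1 𝔣_1†)(𝔣_2 𝔣_2†) ⋯ (𝔣_n 𝔣_n†)`. -/
def Iel (n : ℕ) : Cl n := ((List.finRange n).map (fun j => ff n j * ffd n j)).prod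

/-- The element `𝔣_{k_1}† ⋯ 𝔣_{k_r}† I` for `s = {k_1 < ⋯ < k_r}`. -/
def blade (n : ℕ) (s : Finset (Fin n)) : Cl n :=
  ((s.sort (· ≤ ·)).map (ffd n)).prod * Iel n

/-- The homogeneous part `(∧_n†)^{(r)} I` of spinor space. -/
def Lam (n r : ℕ) : Submodule ℂ (Cl n) :=
  Submodule.span ℂ {x | ∃ s : Finset (Fin n), s.card = r ∧ x = blade n s}

/-- The subspace `(∧_{n-1}†)^{(r)}(𝔣_1†,…,𝔣_{n-1}†) I` (all indices `≤ n-1`). -/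
def LamT (n r : ℕ) : Submodule ℂ (Cl n) :=
  Submodule.span ℂ
    {x | ∃ s : Finset (Fin n), s.card = r ∧ (∀ j ∈ s, (j : ℕ) + 1 < n) ∧ x = blade n s}

/-- The subspace `(∧_{n-1}†)^{(r-1)}(𝔣_1†,…,𝔣_{n-1}†) 𝔣_n† I`: the span of the blades
`𝔣_{k_1}† ⋯ 𝔣_{k_{r-1}}† 𝔣_n† I` with `k_1 < ⋯ < k_{r-1} ≤ n-1`, i.e. of the `r`-blades
whose index set contains `n`. -/
def LamQ (n r : ℕ) : Submodule ℂ (Cl n) :=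
  Submodule.span ℂ
    {x | ∃ s : Finset (Fin n), s.card = r ∧ (∃ j ∈ s, (j : ℕ) + 1 = n) ∧ x = blade n s}

/-- The embedding `ℂ^{n-1} ≃ {z ∈ ℂ^n : z_n = 0} ⊆ ℂ^n`. -/
def embC (n : ℕ) (x : Fin (n - 1) → ℂ) : Fin n → ℂ :=
  fun i => if h : (i : ℕ) < n - 1 then x ⟨i, h⟩ else 0

section WittBasis

theorem polar_negQ (m : ℕ) (v w : Fin m → ℂ) :
    QuadraticMap.polar (negQ ℂ m) v w = -2 * ∑ i, v i * w i := by
  simp only [QuadraticMap.polar, negQ, QuadraticMap.weightedSumSquares_apply, Pi.add_apply,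
    smul_eq_mul, Finset.mul_sum, ← Finset.sum_sub_distrib]
  exact Finset.sum_congr rfl fun i _ => by ring

/-- The vector underlying `ff n j`. -/
def ffVec (n : ℕ) (j : Fin n) : Fin (n + n) → ℂ :=
  (2⁻¹ : ℂ) • (Pi.single (Fin.castAdd n j) 1 - Complex.I • Pi.single (Fin.natAdd n j) 1)

/-- The vector underlying `ffd n j`. -/
def ffdVec (n : ℕ) (j : Fin n) : Fin (n + n) → ℂ :=
  -((2⁻¹ : ℂ) • (Pi.single (Fin.castAdd n j) 1 + Complex.I • Pi.single (Fin.natAdd n j) 1))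

theorem ff_eq_ι (n : ℕ) (j : Fin n) : ff n j = CliffordAlgebra.ι _ (ffVec n j) := by
  simp [ff, ffVec, e]

theorem ffd_eq_ι (n : ℕ) (j : Fin n) : ffd n j = CliffordAlgebra.ι _ (ffdVec n j) := by
  simp [ffd, ffdVec, e]

theorem ffVec_castAdd (n : ℕ) (j i : Fin n) :
    ffVec n j (Fin.castAdd n i) = if i = j then 2⁻¹ else 0 := by
  have h : Fin.castAdd n i ≠ Fin.natAdd n j := fun h => by
    have := congrArg Fin.val h; simp at this; omega
  simp [ffVec, Pi.single_apply, h, -Fin.natAdd_eq_addNat]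

theorem ffVec_natAdd (n : ℕ) (j i : Fin n) :
    ffVec n j (Fin.natAdd n i) = if i = j then -(2⁻¹ * Complex.I) else 0 := by
  have h : Fin.natAdd n i ≠ Fin.castAdd n j := fun h => by
    have := congrArg Fin.val h; simp at this; omega
  simp [ffVec, Pi.single_apply, h, -Fin.natAdd_eq_addNat, neg_ite]

theorem ffdVec_castAdd (n : ℕ) (j i : Fin n) :
    ffdVec n j (Fin.castAdd n i) = if i = j then -2⁻¹ else 0 := by
  have h : Fin.castAdd n i ≠ Fin.natAdd n j := fun h => by
    have := congrArg Fin.val h; simp at this; omega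
  simp [ffdVec, Pi.single_apply, h, -Fin.natAdd_eq_addNat, neg_ite]

theorem ffdVec_natAdd (n : ℕ) (j i : Fin n) :
    ffdVec n j (Fin.natAdd n i) = if i = j then -(2⁻¹ * Complex.I) else 0 := by
  have h : Fin.natAdd n i ≠ Fin.castAdd n j := fun h => by
    have := congrArg Fin.val h; simp at this; omega
  simp [ffdVec, Pi.single_apply, h, -Fin.natAdd_eq_addNat, neg_ite]

theorem ffd_mul_ffd_add_swap (n : ℕ) (j k : Fin n) :
    ffd n j * ffd n k + ffd n k * ffd n j = 0 := by
  have h : -2 * ∑ i, ffdVec n j i * ffdVec n k i = 0 := by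
    simp only [Fin.sum_univ_add, ffdVec_castAdd, ffdVec_natAdd]
    by_cases h : j = k
    · subst h
      simp
      linear_combination (4⁻¹ : ℂ) * Complex.I_sq
    · simp [Ne.symm h]
  rw [ffd_eq_ι, ffd_eq_ι, CliffordAlgebra.ι_mul_ι_add_swap, polar_negQ, h, map_zero]

theorem ff_mul_ff_add_swap (n : ℕ) (j k : Fin n) :
    ff n j * ff n k + ff n k * ff n j = 0 := by
  have h : -2 * ∑ i, ffVec n j i * ffVec n k i = 0 := by
    simp only [Fin.sum_univ_add, ffVec_castAdd, ffVec_natAdd]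
    by_cases h : j = k
    · subst h
      simp
      linear_combination (4⁻¹ : ℂ) * Complex.I_sq
    · simp [Ne.symm h]
  rw [ff_eq_ι, ff_eq_ι, CliffordAlgebra.ι_mul_ι_add_swap, polar_negQ, h, map_zero]

theorem ff_mul_ffd_add_swap (n : ℕ) (j k : Fin n) :
    ff n j * ffd n k + ffd n k * ff n j = if j = k then 1 else 0 := by
  have h : -2 * ∑ i, ffVec n j i * ffdVec n k i = if j = k then 1 else 0 := by
    simp only [Fin.sum_univ_add, ffVec_castAdd, ffVec_natAdd, ffdVec_castAdd, ffdVec_natAdd]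
    by_cases h : j = k
    · subst h
      simp
      linear_combination (-2⁻¹ : ℂ) * Complex.I_sq
    · simp [h, Ne.symm h]
  rw [ff_eq_ι, ffd_eq_ι, CliffordAlgebra.ι_mul_ι_add_swap, polar_negQ, h]
  split_ifs <;> simp

theorem ffd_mul_self (n : ℕ) (j : Fin n) : ffd n j * ffd n j = 0 := by
  have h := ffd_mul_ffd_add_swap n j j
  rwa [← two_smul ℂ, smul_eq_zero_iff_right two_ne_zero] at h

theorem ff_mul_self (n : ℕ) (j : Fin n) : ff n j * ff n j = 0 := by
  have h := ff_mul_ff_add_swap n j j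
  rwa [← two_smul ℂ, smul_eq_zero_iff_right two_ne_zero] at h

/-- `𝔣_j` annihilates the idempotent `I`. -/
theorem ff_mul_Iel (n : ℕ) (j : Fin n) : ff n j * Iel n = 0 := by
  have key : ∀ l : List (Fin n), j ∈ l →
      ff n j * (l.map fun j => ff n j * ffd n j).prod = 0 := by
    intro l
    induction l with
    | nil => simp
    | cons k l ih =>
      intro hl
      rw [List.map_cons, List.prod_cons]
      by_cases hjk : j = k
      · subst hjk
        rw [← mul_assoc, ← mul_assoc, ff_mul_self, zero_mul, zero_mul]
      · have h1 := eq_neg_of_add_eq_zero_left (ff_mul_ff_add_swap n j k)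
        have h2 : ff n j * ffd n k = -(ffd n k * ff n j) := by
          have := ff_mul_ffd_add_swap n j k
          rw [if_neg hjk] at this
          exact eq_neg_of_add_eq_zero_left this
        have : ff n j * (ff n k * ffd n k) = (ff n k * ffd n k) * ff n j := by
          rw [← mul_assoc, h1, neg_mul, mul_assoc, h2, mul_neg, neg_neg, mul_assoc]
        rw [← mul_assoc, this, mul_assoc, ih ((List.mem_cons.1 hl).resolve_left hjk), mul_zero]
  exact key _ (List.mem_finRange j)

/-- The linear form by which the vector `v` contracts in the Fock representation. -/
def fockDual (n : ℕ) : (Fin (n + n) → ℂ) →ₗ[ℂ] Module.Dual ℂ (Fin n → ℂ) :=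
  ∑ j : Fin n, (LinearMap.proj (Fin.castAdd n j) +
    Complex.I • LinearMap.proj (Fin.natAdd n j) :
      (Fin (n + n) → ℂ) →ₗ[ℂ] ℂ).smulRight (LinearMap.proj j : (Fin n → ℂ) →ₗ[ℂ] ℂ)

/-- The vector by which the vector `v` multiplies in the Fock representation. -/
def fockWedge (n : ℕ) : (Fin (n + n) → ℂ) →ₗ[ℂ] (Fin n → ℂ) :=
  LinearMap.pi fun j : Fin n => (-LinearMap.proj (Fin.castAdd n j) +
    Complex.I • LinearMap.proj (Fin.natAdd n j) : (Fin (n + n) → ℂ) →ₗ[ℂ] ℂ)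

theorem fockDual_fockWedge (n : ℕ) (v : Fin (n + n) → ℂ) :
    fockDual n v (fockWedge n v) = negQ ℂ (n + n) v := by
  simp [fockDual, fockWedge, negQ, QuadraticMap.weightedSumSquares_apply, Fin.sum_univ_add,
    LinearMap.sum_apply, -Fin.natAdd_eq_addNat]
  rw [← Finset.sum_neg_distrib, ← Finset.sum_neg_distrib, ← Finset.sum_add_distrib]
  refine Finset.sum_congr rfl fun i _ => ?_
  linear_combination (v (Fin.natAdd n i))^2 * Complex.I_sq

theorem fockWedge_ffVec (n : ℕ) (j : Fin n) : fockWedge n (ffVec n j) = 0 := by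
  ext i
  by_cases h : i = j
  · simp [fockWedge, ffVec_castAdd, ffVec_natAdd, h, -Fin.natAdd_eq_addNat]
    linear_combination (-2⁻¹ : ℂ) * Complex.I_sq
  · simp [fockWedge, ffVec_castAdd, ffVec_natAdd, h, -Fin.natAdd_eq_addNat]

/-- The action of a vector in the Fock representation on the exterior algebra of `ℂ^n`, the sum of
a contraction and an exterior multiplication. -/
def fockVec (n : ℕ) :
    (Fin (n + n) → ℂ) →ₗ[ℂ] Module.End ℂ (CliffordAlgebra (0 : QuadraticForm ℂ (Fin n → ℂ))) :=
  CliffordAlgebra.contractLeft ∘ₗ fockDual n +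
    LinearMap.mul ℂ _ ∘ₗ CliffordAlgebra.ι _ ∘ₗ fockWedge n

theorem fockVec_apply (n : ℕ) (v : Fin (n + n) → ℂ)
    (x : CliffordAlgebra (0 : QuadraticForm ℂ (Fin n → ℂ))) :
    fockVec n v x = CliffordAlgebra.contractLeft (fockDual n v) x +
      CliffordAlgebra.ι _ (fockWedge n v) * x := rfl

theorem fockVec_mul_self (n : ℕ) (v : Fin (n + n) → ℂ) :
    fockVec n v * fockVec n v = algebraMap ℂ _ (negQ ℂ (n + n) v) := by
  refine LinearMap.ext fun x => ?_
  rw [Module.End.mul_apply, fockVec_apply, fockVec_apply, Module.algebraMap_end_apply, map_add,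
    CliffordAlgebra.contractLeft_contractLeft, zero_add, CliffordAlgebra.contractLeft_ι_mul,
    mul_add, ← mul_assoc, CliffordAlgebra.ι_sq_scalar, fockDual_fockWedge]
  simp

/-- The Fock representation of the Clifford algebra. -/
def fock (n : ℕ) : Cl n →ₐ[ℂ]
    Module.End ℂ (CliffordAlgebra (0 : QuadraticForm ℂ (Fin n → ℂ))) :=
  CliffordAlgebra.lift _ ⟨fockVec n, fockVec_mul_self n⟩

theorem fock_ff_one (n : ℕ) (j : Fin n) : fock n (ff n j) 1 = 0 := by
  rw [ff_eq_ι, fock, CliffordAlgebra.lift_ι_apply, fockVec_apply, fockWedge_ffVec, map_zero,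
    zero_mul, add_zero, CliffordAlgebra.contractLeft_one]

theorem Iel_ne_zero (n : ℕ) : Iel n ≠ 0 := by
  have step : ∀ j : Fin n, fock n (ff n j * ffd n j) 1 = 1 := by
    intro j
    have h := ff_mul_ffd_add_swap n j j
    rw [if_pos rfl] at h
    rw [eq_sub_of_add_eq h, map_sub, map_one (fock n), map_mul (fock n), LinearMap.sub_apply,
      Module.End.mul_apply, fock_ff_one, map_zero, sub_zero, Module.End.one_apply]
  have key : ∀ l : List (Fin n), fock n (l.map fun j => ff n j * ffd n j).prod 1 = 1 := by
    intro l
    induction l with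
    | nil => simp
    | cons k l ih =>
      rw [List.map_cons, List.prod_cons, map_mul (fock n), Module.End.mul_apply, ih, step]
  intro h
  have := key (List.finRange n)
  rw [← Iel, h, map_zero, LinearMap.zero_apply] at this
  exact zero_ne_one this

end WittBasis

section Blades

/-- The product `𝔣_{k_1}† ⋯ 𝔣_{k_r}†` depends on the order of the factors only up to sign. -/
theorem exists_prod_map_ffd_eq_smul (n : ℕ) {l l' : List (Fin n)} (h : l.Perm l') :
    ∃ c : ℂ, c ≠ 0 ∧ (l.map (ffd n)).prod = c • (l'.map (ffd n)).prod := by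
  induction h with
  | nil => exact ⟨1, one_ne_zero, by simp⟩
  | cons x _ ih =>
    obtain ⟨c, hc, h⟩ := ih
    exact ⟨c, hc, by simp [h]⟩
  | swap x y l =>
    refine ⟨-1, by simp, ?_⟩
    simp only [List.map_cons, List.prod_cons, ← mul_assoc]
    rw [eq_neg_of_add_eq_zero_left (ffd_mul_ffd_add_swap n y x)]
    simp
  | trans _ _ ih₁ ih₂ =>
    obtain ⟨c, hc, h⟩ := ih₁
    obtain ⟨d, hd, h'⟩ := ih₂
    exact ⟨c * d, mul_ne_zero hc hd, by rw [h, h', smul_smul]⟩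

theorem exists_ffd_mul_blade (n : ℕ) {j : Fin n} {s : Finset (Fin n)} (hj : j ∉ s) :
    ∃ c : ℂ, c ≠ 0 ∧ ffd n j * blade n s = c • blade n (insert j s) := by
  have hp : List.Perm (j :: s.sort (· ≤ ·)) ((insert j s).sort (· ≤ ·)) := by
    refine (List.perm_ext_iff_of_nodup ?_ (Finset.sort_nodup _ _)).2 fun a => by simp
    exact List.nodup_cons.2 ⟨by simpa using hj, Finset.sort_nodup _ _⟩
  obtain ⟨c, hc, h⟩ := exists_prod_map_ffd_eq_smul n hp
  refine ⟨c, hc, ?_⟩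
  rw [blade, blade, ← mul_assoc, ← smul_mul_assoc, ← h, List.map_cons, List.prod_cons]

theorem ff_mul_blade_of_notMem (n : ℕ) {j : Fin n} {s : Finset (Fin n)} (hj : j ∉ s) :
    ff n j * blade n s = 0 := by
  have key : ∀ l : List (Fin n), j ∉ l → ff n j * ((l.map (ffd n)).prod * Iel n) = 0 := by
    intro l
    induction l with
    | nil => simp [ff_mul_Iel]
    | cons k l ih =>
      intro hl
      rw [List.mem_cons, not_or] at hl
      have h := ff_mul_ffd_add_swap n j k
      rw [if_neg hl.1] at h
      rw [List.map_cons, List.prod_cons, mul_assoc, ← mul_assoc,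
        eq_neg_of_add_eq_zero_left h, neg_mul, mul_assoc, ih hl.2, mul_zero, neg_zero]
  exact key _ (by simpa using hj)

theorem ff_mul_ffd_mul_blade (n : ℕ) {j : Fin n} {s : Finset (Fin n)} (hj : j ∉ s) :
    ff n j * (ffd n j * blade n s) = blade n s := by
  have h := ff_mul_ffd_add_swap n j j
  rw [if_pos rfl] at h
  rw [← mul_assoc, eq_sub_of_add_eq h, sub_mul, one_mul, mul_assoc, ff_mul_blade_of_notMem n hj,
    mul_zero, sub_zero]

theorem exists_blade_eq_smul_ffd_mul (n : ℕ) {j : Fin n} {s : Finset (Fin n)} (hj : j ∈ s) :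
    ∃ c : ℂ, c ≠ 0 ∧ blade n s = c • (ffd n j * blade n (s.erase j)) := by
  obtain ⟨c, hc, h⟩ := exists_ffd_mul_blade n (Finset.notMem_erase j s)
  exact ⟨c⁻¹, inv_ne_zero hc, by rw [h, Finset.insert_erase hj, inv_smul_smul₀ hc]⟩

theorem ffd_mul_blade_of_mem (n : ℕ) {j : Fin n} {s : Finset (Fin n)} (hj : j ∈ s) :
    ffd n j * blade n s = 0 := by
  obtain ⟨c, -, h⟩ := exists_blade_eq_smul_ffd_mul n hj
  rw [h, mul_smul_comm, ← mul_assoc, ffd_mul_self, zero_mul, smul_zero]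

theorem exists_ff_mul_blade (n : ℕ) {j : Fin n} {s : Finset (Fin n)} (hj : j ∈ s) :
    ∃ c : ℂ, ff n j * blade n s = c • blade n (s.erase j) := by
  obtain ⟨c, -, h⟩ := exists_blade_eq_smul_ffd_mul n hj
  exact ⟨c, by rw [h, mul_smul_comm, ff_mul_ffd_mul_blade n (Finset.notMem_erase j s)]⟩

/-- Blades are eigenvectors of the number operators `𝔣_j† 𝔣_j`. -/
theorem ffd_mul_ff_mul_blade (n : ℕ) (j : Fin n) (s : Finset (Fin n)) :
    ffd n j * (ff n j * blade n s) = if j ∈ s then blade n s else 0 := by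
  split_ifs with hj
  · have h := ff_mul_ffd_add_swap n j j
    rw [if_pos rfl] at h
    rw [← mul_assoc, eq_sub_of_add_eq' h, sub_mul, one_mul, mul_assoc, ffd_mul_blade_of_mem n hj,
      mul_zero, sub_zero]
  · rw [ff_mul_blade_of_notMem n hj, mul_zero]

theorem blade_ne_zero (n : ℕ) (s : Finset (Fin n)) : blade n s ≠ 0 := by
  induction s using Finset.induction_on with
  | empty => simpa [blade] using Iel_ne_zero n
  | insert j s hj ih =>
    intro h0
    obtain ⟨c, -, h⟩ := exists_ffd_mul_blade n hj
    have := ff_mul_ffd_mul_blade n hj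
    rw [h, h0, smul_zero, mul_zero] at this
    exact ih this.symm

theorem linearIndependent_blade (n : ℕ) : LinearIndependent ℂ (blade n) := by
  refine Module.End.eigenvectors_linearIndependent'
    (∑ j : Fin n, (2 ^ (j : ℕ) : ℂ) • (LinearMap.mulLeft ℂ (ffd n j) ∘ₗ
      LinearMap.mulLeft ℂ (ff n j)))
    (fun s : Finset (Fin n) => ((∑ j ∈ s, 2 ^ (j : ℕ) : ℕ) : ℂ)) ?_ _ fun s => ?_
  · intro s t h
    have h' : ∑ j ∈ s.map Fin.valEmbedding, 2 ^ j = ∑ j ∈ t.map Fin.valEmbedding, 2 ^ j := by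
      simpa using Nat.cast_injective h
    exact Finset.map_injective _ (Finset.geomSum_injective le_rfl h')
  · refine ⟨Module.End.mem_eigenspace_iff.2 ?_, blade_ne_zero n s⟩
    simp only [LinearMap.sum_apply, LinearMap.smul_apply, LinearMap.comp_apply,
      LinearMap.mulLeft_apply, ffd_mul_ff_mul_blade]
    simp [Finset.sum_smul, Finset.sum_ite_mem]

theorem blade_mem_LamT {n r : ℕ} {s : Finset (Fin n)} (hs : s.card = r)
    (hs' : ∀ j ∈ s, (j : ℕ) + 1 < n) : blade n s ∈ LamT n r :=
  Submodule.subset_span ⟨s, hs, hs', rfl⟩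

theorem finrank_LamT (n r : ℕ) : Module.finrank ℂ (LamT n r) = Nat.choose (n - 1) r := by
  let S : Finset (Finset (Fin n)) :=
    Finset.powersetCard r (Finset.univ.filter fun j : Fin n => (j : ℕ) + 1 < n)
  have hS : LamT n r = Submodule.span ℂ (Set.range (blade n ∘ ((↑) : S → Finset (Fin n)))) := by
    rw [LamT]
    congr 1
    ext x
    simp only [Set.mem_ofPred_eq, Set.mem_range, Function.comp_apply, Subtype.exists, S,
      Finset.mem_powersetCard,
      Finset.subset_iff, Finset.mem_filter, Finset.mem_univ, true_and, exists_prop]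
    exact ⟨fun ⟨s, h₁, h₂, h⟩ => ⟨s, ⟨fun _ h => h₂ _ h, h₁⟩, h.symm⟩,
      fun ⟨s, ⟨h₂, h₁⟩, h⟩ => ⟨s, h₁, fun _ h => h₂ h, h.symm⟩⟩
  rw [hS, finrank_span_eq_card ((linearIndependent_blade n).comp _ Subtype.val_injective),
    Fintype.card_coe, Finset.card_powersetCard]
  congr 1
  rcases n with _ | n
  · simp
  · have : (Finset.univ.filter fun j : Fin (n + 1) => (j : ℕ) + 1 < n + 1) =
        Finset.Iio (Fin.last n) := by
      ext j
      simp only [Finset.mem_filter, Finset.mem_univ, true_and, Finset.mem_Iio, Fin.lt_def,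
        Fin.val_last]
      omega
    rw [this]
    simp

theorem castLE_add_one_lt {n : ℕ} (j : Fin (n - 1)) :
    (Fin.castLE (Nat.sub_le n 1) j : ℕ) + 1 < n := by
  have := j.2
  simp only [Fin.val_castLE]
  omega

theorem ffd_mul_mem_LamT {n r : ℕ} (j : Fin (n - 1)) {x : Cl n} (hx : x ∈ LamT n r) :
    ffd n (Fin.castLE (Nat.sub_le n 1) j) * x ∈ LamT n (r + 1) := by
  refine (Submodule.span_le (p := (LamT n (r + 1)).comap (LinearMap.mulLeft ℂ
    (ffd n (Fin.castLE (Nat.sub_le n 1) j))))).2 ?_ hx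
  rintro _ ⟨s, hs, hs', rfl⟩
  simp only [SetLike.mem_coe, Submodule.mem_comap, LinearMap.mulLeft_apply]
  by_cases hj : Fin.castLE (Nat.sub_le n 1) j ∈ s
  · rw [ffd_mul_blade_of_mem n hj]
    exact zero_mem _
  · obtain ⟨c, -, h⟩ := exists_ffd_mul_blade n hj
    rw [h]
    refine Submodule.smul_mem _ _ (blade_mem_LamT (by rw [Finset.card_insert_of_notMem hj, hs]) ?_)
    intro k hk
    rcases Finset.mem_insert.1 hk with rfl | hk
    · exact castLE_add_one_lt j
    · exact hs' k hk

theorem ff_mul_mem_LamT {n r : ℕ} (j : Fin n) {x : Cl n} (hx : x ∈ LamT n (r + 1)) :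
    ff n j * x ∈ LamT n r := by
  refine (Submodule.span_le (p := (LamT n r).comap (LinearMap.mulLeft ℂ (ff n j)))).2 ?_ hx
  rintro _ ⟨s, hs, hs', rfl⟩
  simp only [SetLike.mem_coe, Submodule.mem_comap, LinearMap.mulLeft_apply]
  by_cases hj : j ∈ s
  · obtain ⟨c, h⟩ := exists_ff_mul_blade n hj
    rw [h]
    refine Submodule.smul_mem _ _ (blade_mem_LamT (by rw [Finset.card_erase_of_mem hj, hs]; rfl) ?_)
    exact fun k hk => hs' k (Finset.mem_of_mem_erase hk)
  · rw [ff_mul_blade_of_notMem n hj]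
    exact zero_mem _

/-- The total number operator acts on `(∧_{n-1}†)^{(r)} I` as multiplication by `r`. -/
theorem sum_ffd_mul_ff_mul {n r : ℕ} {x : Cl n} (hx : x ∈ LamT n r) :
    ∑ j : Fin (n - 1), ffd n (Fin.castLE (Nat.sub_le n 1) j) *
      (ff n (Fin.castLE (Nat.sub_le n 1) j) * x) = (r : ℂ) • x := by
  refine (Submodule.span_le (p := LinearMap.eqLocus
    (∑ j : Fin (n - 1), LinearMap.mulLeft ℂ (ffd n (Fin.castLE (Nat.sub_le n 1) j)) ∘ₗ
      LinearMap.mulLeft ℂ (ff n (Fin.castLE (Nat.sub_le n 1) j)))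
    ((r : ℂ) • LinearMap.id))).2 ?_ hx |> fun h => by simpa using h
  rintro _ ⟨s, hs, hs', rfl⟩
  simp only [SetLike.mem_coe, LinearMap.mem_eqLocus, LinearMap.sum_apply, LinearMap.comp_apply,
    LinearMap.mulLeft_apply, ffd_mul_ff_mul_blade, LinearMap.smul_apply, LinearMap.id_apply]
  rw [← Finset.sum_filter, Finset.sum_const, ← hs, Nat.cast_smul_eq_nsmul]
  congr 1
  refine Finset.card_bij (fun j _ => Fin.castLE (Nat.sub_le n 1) j) (by simp)
    (fun _ _ _ _ h => Fin.castLE_injective _ h) fun k hk => ?_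
  exact ⟨⟨k, by have := hs' k hk; omega⟩, by simpa using hk, rfl⟩

end Blades

section PolynomialComplex

open MvPolynomial TensorProduct

/-- Polynomials in `z_1, …, z_m` (left summand) and their conjugates (right summand). -/
abbrev ZPoly (m : ℕ) : Type := MvPolynomial (Fin m ⊕ Fin m) ℂ

/-- Exponents of bidegree `(a, b)`. -/
def biExp (m a b : ℕ) : Set (Fin m ⊕ Fin m →₀ ℕ) :=
  {d | ∑ j, d (Sum.inl j) = a ∧ ∑ j, d (Sum.inr j) = b}

/-- Scalar polynomials of bidegree `(a, b)`. -/
def biPoly (m a b : ℕ) : Submodule ℂ (ZPoly m) := restrictSupport ℂ (biExp m a b)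

/-- Exponents of bidegree `(a, b)` are pairs of multisets of sizes `a` and `b`. -/
def biExpEquiv (m a b : ℕ) : biExp m a b ≃ Sym (Fin m) a × Sym (Fin m) b :=
  ((Finsupp.equivFunOnFinite.trans (Equiv.sumArrowEquivProdArrow _ _ _)).subtypeEquiv
    (q := fun p => ∑ j, p.1 j = a ∧ ∑ j, p.2 j = b) fun _ => Iff.rfl).trans
  (Equiv.subtypeProdEquivProd.trans
    ((Sym.equivNatSumOfFintype _ _).symm.prodCongr (Sym.equivNatSumOfFintype _ _).symm))

instance (m a b : ℕ) : Finite (biExp m a b) := Finite.of_equiv _ (biExpEquiv m a b).symm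

instance (m a b : ℕ) : FiniteDimensional ℂ (biPoly m a b) :=
  Module.Finite.of_basis (basisRestrictSupport ℂ (biExp m a b))

theorem finrank_biPoly (m a b : ℕ) :
    Module.finrank ℂ (biPoly m a b) = m.multichoose a * m.multichoose b := by
  refine (Module.finrank_eq_nat_card_basis (basisRestrictSupport ℂ (biExp m a b))).trans ?_
  rw [Nat.card_congr (biExpEquiv m a b), Nat.card_prod, Nat.card_eq_fintype_card,
    Nat.card_eq_fintype_card, Sym.card_sym_eq_multichoose, Sym.card_sym_eq_multichoose,
    Fintype.card_fin]

theorem biPoly_le_iff {m a b : ℕ} {W : Submodule ℂ (ZPoly m)} :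
    biPoly m a b ≤ W ↔ ∀ d ∈ biExp m a b, monomial d 1 ∈ W := by
  rw [biPoly, restrictSupport_eq_span, Submodule.span_le, Set.image_subset_iff]
  rfl

theorem pderiv_mem_biPoly {m a b : ℕ} (j : Fin m) {f : ZPoly m} (hf : f ∈ biPoly m (a + 1) b) :
    pderiv (Sum.inl j) f ∈ biPoly m a b := by
  refine biPoly_le_iff (W := (biPoly m a b).comap (pderiv (Sum.inl j)).toLinearMap) |>.2 ?_ hf
  rintro d ⟨hd, hd'⟩
  simp only [Submodule.mem_comap, Derivation.coeFn_coe, pderiv_monomial, biPoly,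
    monomial_mem_restrictSupport]
  by_cases h : d (Sum.inl j) = 0
  · simp [h]
  · refine Or.inl ⟨?_, by simpa using hd'⟩
    have h1 : ∀ i, (d - Finsupp.single (Sum.inl j) 1 : Fin m ⊕ Fin m →₀ ℕ) (Sum.inl i) +
        (if i = j then 1 else 0) =
        d (Sum.inl i) := by
      intro i
      by_cases hij : i = j
      · subst hij
        simp
        omega
      · simp [hij]
    have h2 := Finset.sum_congr rfl fun i (_ : i ∈ Finset.univ) => h1 i
    rw [Finset.sum_add_distrib, hd] at h2
    simpa using h2

theorem pderiv_eq_zero_of_mem_biPoly {m b : ℕ} (j : Fin m) {f : ZPoly m}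
    (hf : f ∈ biPoly m 0 b) : pderiv (Sum.inl j) f = 0 := by
  refine biPoly_le_iff (W := LinearMap.ker (pderiv (Sum.inl j)).toLinearMap) |>.2 ?_ hf
  rintro d ⟨hd, -⟩
  rw [Finset.sum_eq_zero_iff] at hd
  simp [hd j (Finset.mem_univ j)]

theorem X_mul_mem_biPoly {m a b : ℕ} (j : Fin m) {f : ZPoly m} (hf : f ∈ biPoly m a b) :
    X (Sum.inl j) * f ∈ biPoly m (a + 1) b := by
  refine biPoly_le_iff (W := (biPoly m (a + 1) b).comap (LinearMap.mulLeft ℂ (X (Sum.inl j))))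
    |>.2 ?_ hf
  rintro d ⟨hd, hd'⟩
  simp only [Submodule.mem_comap, LinearMap.mulLeft_apply, X, monomial_mul, one_mul, biPoly,
    monomial_mem_restrictSupport]
  refine Or.inl ⟨?_, by simpa using hd'⟩
  simp [Finset.sum_add_distrib, hd, Finsupp.single_apply, add_comm]

/-- Euler's identity in the holomorphic variables. -/
theorem sum_X_mul_pderiv {m a b : ℕ} {f : ZPoly m} (hf : f ∈ biPoly m a b) :
    ∑ j : Fin m, X (Sum.inl j) * pderiv (Sum.inl j) f = (a : ℂ) • f := by
  have h : f ∈ LinearMap.eqLocus (∑ j : Fin m, LinearMap.mulLeft ℂ (X (Sum.inl j)) ∘ₗ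
      (pderiv (Sum.inl j)).toLinearMap) ((a : ℂ) • LinearMap.id) := by
    refine biPoly_le_iff.2 ?_ hf
    rintro d ⟨hd, -⟩
    simp only [LinearMap.mem_eqLocus, LinearMap.sum_apply, LinearMap.comp_apply,
      LinearMap.mulLeft_apply, Derivation.coeFn_coe, X_mul_pderiv_monomial, LinearMap.smul_apply,
      LinearMap.id_apply]
    rw [← Finset.sum_smul, hd, Nat.cast_smul_eq_nsmul]
  simpa using h

theorem pderiv_comm {m : ℕ} (j k : Fin m ⊕ Fin m) (f : ZPoly m) :
    pderiv j (pderiv k f) = pderiv k (pderiv j f) := by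
  have h : ⁅(pderiv j : Derivation ℂ (ZPoly m) (ZPoly m)),
      (pderiv k : Derivation ℂ (ZPoly m) (ZPoly m))⁆ = 0 := by
    refine derivation_ext fun i => ?_
    classical
    rw [Derivation.commutator_apply, pderiv_X, pderiv_X]
    by_cases h1 : i = j <;> by_cases h2 : i = k <;> simp [Pi.single_apply, h1, h2, apply_ite]
  have := congrArg (fun D => D f) h
  rwa [Derivation.commutator_apply, Derivation.zero_apply, sub_eq_zero] at this

/-- The restricted Dirac operator `∂z̃` on Clifford-valued polynomials. -/
def dirac (n : ℕ) : (ZPoly (n - 1) ⊗[ℂ] Cl n) →ₗ[ℂ] (ZPoly (n - 1) ⊗[ℂ] Cl n) :=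
  ∑ j : Fin (n - 1), TensorProduct.map (pderiv (Sum.inl j)).toLinearMap
    (LinearMap.mulLeft ℂ (ffd n (Fin.castLE (Nat.sub_le n 1) j)))

/-- The operator `∑ z_j 𝔣_j`, which is dual to `∂z̃`. -/
def codirac (n : ℕ) : (ZPoly (n - 1) ⊗[ℂ] Cl n) →ₗ[ℂ] (ZPoly (n - 1) ⊗[ℂ] Cl n) :=
  ∑ j : Fin (n - 1), TensorProduct.map (LinearMap.mulLeft ℂ (X (Sum.inl j)))
    (LinearMap.mulLeft ℂ (ff n (Fin.castLE (Nat.sub_le n 1) j)))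

theorem dirac_tmul (n : ℕ) (f : ZPoly (n - 1)) (c : Cl n) :
    dirac n (f ⊗ₜ c) = ∑ j : Fin (n - 1),
      pderiv (Sum.inl j) f ⊗ₜ (ffd n (Fin.castLE (Nat.sub_le n 1) j) * c) := by
  simp [dirac, LinearMap.sum_apply]

theorem codirac_tmul (n : ℕ) (f : ZPoly (n - 1)) (c : Cl n) :
    codirac n (f ⊗ₜ c) = ∑ j : Fin (n - 1),
      (X (Sum.inl j) * f) ⊗ₜ (ff n (Fin.castLE (Nat.sub_le n 1) j) * c) := by
  simp [codirac, LinearMap.sum_apply]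

/-- Polynomials of bidegree `(a, b)` with values in `(∧_{n-1}†)^{(r)} I`. -/
def polySpace (n a b r : ℕ) : Submodule ℂ (ZPoly (n - 1) ⊗[ℂ] Cl n) :=
  LinearMap.range (TensorProduct.mapIncl (biPoly (n - 1) a b) (LamT n r))

instance (n r : ℕ) : FiniteDimensional ℂ (LamT n r) := by
  refine FiniteDimensional.span_of_finite ℂ ((Set.finite_range (blade n)).subset ?_)
  rintro _ ⟨s, -, -, rfl⟩
  exact ⟨s, rfl⟩

instance (n a b r : ℕ) : FiniteDimensional ℂ (polySpace n a b r) := by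
  unfold polySpace
  infer_instance

theorem finrank_polySpace (n a b r : ℕ) : Module.finrank ℂ (polySpace n a b r) =
    (n - 1).multichoose a * (n - 1).multichoose b * (n - 1).choose r := by
  have h : Function.Injective (TensorProduct.mapIncl (biPoly (n - 1) a b) (LamT n r)) :=
    TensorProduct.map_injective_of_flat_flat _ _ Subtype.val_injective Subtype.val_injective
  rw [polySpace, LinearMap.finrank_range_of_inj h, Module.finrank_tensorProduct, finrank_biPoly,
    finrank_LamT]

theorem polySpace_le_iff {n a b r : ℕ} {W : Submodule ℂ (ZPoly (n - 1) ⊗[ℂ] Cl n)} :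
    polySpace n a b r ≤ W ↔ ∀ f ∈ biPoly (n - 1) a b, ∀ c ∈ LamT n r, f ⊗ₜ c ∈ W := by
  rw [polySpace, TensorProduct.range_mapIncl, Submodule.map₂_le]
  rfl

theorem tmul_mem_polySpace {n a b r : ℕ} {f : ZPoly (n - 1)} {c : Cl n}
    (hf : f ∈ biPoly (n - 1) a b) (hc : c ∈ LamT n r) : f ⊗ₜ c ∈ polySpace n a b r :=
  polySpace_le_iff.1 le_rfl f hf c hc

theorem dirac_mem_polySpace {n a b r : ℕ} {x : ZPoly (n - 1) ⊗[ℂ] Cl n}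
    (hx : x ∈ polySpace n (a + 1) b r) : dirac n x ∈ polySpace n a b (r + 1) := by
  refine (polySpace_le_iff (W := (polySpace n a b (r + 1)).comap (dirac n))).2 ?_ hx
  intro f hf c hc
  rw [Submodule.mem_comap, dirac_tmul]
  exact sum_mem fun j _ => tmul_mem_polySpace (pderiv_mem_biPoly j hf) (ffd_mul_mem_LamT j hc)

theorem dirac_eq_zero_of_mem_polySpace {n b r : ℕ} {x : ZPoly (n - 1) ⊗[ℂ] Cl n}
    (hx : x ∈ polySpace n 0 b r) : dirac n x = 0 := by
  refine (polySpace_le_iff (W := LinearMap.ker (dirac n))).2 ?_ hx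
  intro f hf c hc
  rw [LinearMap.mem_ker, dirac_tmul]
  exact Finset.sum_eq_zero fun j _ => by rw [pderiv_eq_zero_of_mem_biPoly j hf, zero_tmul]

theorem codirac_mem_polySpace {n a b r : ℕ} {x : ZPoly (n - 1) ⊗[ℂ] Cl n}
    (hx : x ∈ polySpace n a b (r + 1)) : codirac n x ∈ polySpace n (a + 1) b r := by
  refine (polySpace_le_iff (W := (polySpace n (a + 1) b r).comap (codirac n))).2 ?_ hx
  intro f hf c hc
  rw [Submodule.mem_comap, codirac_tmul]
  exact sum_mem fun j _ => tmul_mem_polySpace (X_mul_mem_biPoly j hf) (ff_mul_mem_LamT _ hc)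

theorem dirac_dirac (n : ℕ) (x : ZPoly (n - 1) ⊗[ℂ] Cl n) : dirac n (dirac n x) = 0 := by
  induction x with
  | zero => simp
  | add x y hx hy => rw [map_add, map_add, hx, hy, add_zero]
  | tmul f c =>
    rw [dirac_tmul, map_sum]
    simp_rw [dirac_tmul]
    set S := ∑ j : Fin (n - 1), ∑ k : Fin (n - 1),
      pderiv (Sum.inl k) (pderiv (Sum.inl j) f) ⊗ₜ[ℂ]
        (ffd n (Fin.castLE (Nat.sub_le n 1) k) *
          (ffd n (Fin.castLE (Nat.sub_le n 1) j) * c)) with hS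
    have h : S = -S := by
      conv_lhs => rw [hS, Finset.sum_comm]
      rw [hS, ← Finset.sum_neg_distrib]
      refine Finset.sum_congr rfl fun j _ => ?_
      rw [← Finset.sum_neg_distrib]
      refine Finset.sum_congr rfl fun k _ => ?_
      rw [← mul_assoc, ← mul_assoc, eq_neg_of_add_eq_zero_left (ffd_mul_ffd_add_swap n _ _),
        neg_mul, tmul_neg, pderiv_comm]
    have h2 : (2 : ℂ) • S = 0 := by
      rw [two_smul]
      nth_rewrite 1 [h]
      exact neg_add_cancel S
    exact (smul_eq_zero_iff_right two_ne_zero).1 h2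

/-- The Laplace-type identity `∂z̃ ∘ z̃ + z̃ ∘ ∂z̃ = a + r`. -/
theorem dirac_codirac_add {n a b r : ℕ} {x : ZPoly (n - 1) ⊗[ℂ] Cl n}
    (hx : x ∈ polySpace n a b r) :
    dirac n (codirac n x) + codirac n (dirac n x) = ((a : ℂ) + r) • x := by
  have h : x ∈ LinearMap.eqLocus (dirac n ∘ₗ codirac n + codirac n ∘ₗ dirac n)
      (((a : ℂ) + r) • LinearMap.id) := by
    refine polySpace_le_iff.2 ?_ hx
    intro f hf c hc
    simp only [LinearMap.mem_eqLocus, LinearMap.add_apply, LinearMap.comp_apply,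
      LinearMap.smul_apply, LinearMap.id_apply, dirac_tmul, codirac_tmul, map_sum]
    rw [Finset.sum_comm, ← Finset.sum_add_distrib]
    have h1 : ∀ j k : Fin (n - 1),
        pderiv (Sum.inl j) (X (Sum.inl k) * f) ⊗ₜ[ℂ] (ffd n (Fin.castLE (Nat.sub_le n 1) j) *
            (ff n (Fin.castLE (Nat.sub_le n 1) k) * c)) +
          (X (Sum.inl k) * pderiv (Sum.inl j) f) ⊗ₜ[ℂ] (ff n (Fin.castLE (Nat.sub_le n 1) k) *
            (ffd n (Fin.castLE (Nat.sub_le n 1) j) * c)) =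
        if j = k then f ⊗ₜ[ℂ] (ffd n (Fin.castLE (Nat.sub_le n 1) j) *
            (ff n (Fin.castLE (Nat.sub_le n 1) j) * c)) +
          (X (Sum.inl j) * pderiv (Sum.inl j) f) ⊗ₜ[ℂ] c else 0 := by
      intro j k
      have hjk := ff_mul_ffd_add_swap n (Fin.castLE (Nat.sub_le n 1) k)
        (Fin.castLE (Nat.sub_le n 1) j)
      rw [← mul_assoc (ff n _), eq_sub_of_add_eq hjk, sub_mul, tmul_sub, mul_assoc (ffd n _)]
      by_cases h : j = k
      · subst h
        rw [if_pos rfl, if_pos rfl, one_mul, Derivation.leibniz, pderiv_X_self, add_tmul,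
          smul_eq_mul, smul_eq_mul, mul_one]
        abel
      · have h' : ¬ (Fin.castLE (Nat.sub_le n 1) k = Fin.castLE (Nat.sub_le n 1) j) := fun h'' =>
          h (Fin.castLE_injective _ h'').symm
        rw [if_neg h, if_neg h', Derivation.leibniz, pderiv_X_of_ne (by simpa using Ne.symm h)]
        simp
    simp_rw [← Finset.sum_add_distrib, h1, Finset.sum_ite_eq, Finset.mem_univ, if_true]
    rw [Finset.sum_add_distrib, ← tmul_sum, ← sum_tmul, sum_ffd_mul_ff_mul hc,
      sum_X_mul_pderiv hf, tmul_smul, add_smul]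
    exact add_comm _ _
  simpa using h

/-- The kernel `𝒳_{a,b,r}` of `∂z̃`. -/
def diracKer (n a b r : ℕ) : Submodule ℂ (ZPoly (n - 1) ⊗[ℂ] Cl n) :=
  polySpace n a b r ⊓ LinearMap.ker (dirac n)

instance (n a b r : ℕ) : FiniteDimensional ℂ (diracKer n a b r) :=
  Submodule.finiteDimensional_of_le (inf_le_left : diracKer n a b r ≤ polySpace n a b r)

theorem diracKer_zero (n b r : ℕ) : diracKer n 0 b r = polySpace n 0 b r :=
  inf_eq_left.2 fun _ hx => LinearMap.mem_ker.2 (dirac_eq_zero_of_mem_polySpace hx)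

/-- The Koszul-type complex defined by `∂z̃` is exact in positive form degree. -/
theorem map_dirac_polySpace (n a b r : ℕ) :
    (polySpace n (a + 1) b r).map (dirac n) = diracKer n a b (r + 1) := by
  ext x
  constructor
  · rintro ⟨y, hy, rfl⟩
    exact ⟨dirac_mem_polySpace hy, LinearMap.mem_ker.2 (dirac_dirac n y)⟩
  · rintro ⟨hx, hx'⟩
    have h := dirac_codirac_add hx
    rw [LinearMap.mem_ker.1 hx', map_zero, add_zero] at h
    have hne : (a : ℂ) + (r + 1 : ℕ) ≠ 0 := by
      norm_cast
    refine ⟨((a : ℂ) + (r + 1 : ℕ))⁻¹ • codirac n x,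
      Submodule.smul_mem _ _ (codirac_mem_polySpace hx), ?_⟩
    rw [map_smul, h, inv_smul_smul₀ hne]

theorem finrank_diracKer_add (n a b r : ℕ) :
    Module.finrank ℂ (diracKer n a b (r + 1)) + Module.finrank ℂ (diracKer n (a + 1) b r) =
      (n - 1).multichoose (a + 1) * (n - 1).multichoose b * (n - 1).choose r := by
  have h := LinearMap.finrank_range_add_finrank_ker (K := ℂ)
    (V := polySpace n (a + 1) b r) (V₂ := ZPoly (n - 1) ⊗[ℂ] Cl n)
    ((dirac n).domRestrict (polySpace n (a + 1) b r))
  rw [LinearMap.range_domRestrict, LinearMap.ker_domRestrict, map_dirac_polySpace,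
    finrank_polySpace] at h
  rw [← h, ← Submodule.finrank_map_subtype_eq, Submodule.map_comap_subtype]
  rfl

theorem finrank_diracKer (m a b r : ℕ) (hr : 1 ≤ r) :
    ((a : ℚ) + r) * Module.finrank ℂ (diracKer (m + 1) a b r) =
      r * m.choose r * (a + m).choose a * m.multichoose b := by
  induction a generalizing r with
  | zero =>
    rw [diracKer_zero, finrank_polySpace]
    simp
    ring
  | succ a ih =>
    have h1 := finrank_diracKer_add (m + 1) a b r
    have h2 := ih (r + 1) (by omega)
    have h3 : ((r : ℚ) + 1) * m.choose (r + 1) = m.choose r * (m - r) := by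
      rcases le_or_gt r m with h | h
      · have := Nat.choose_succ_right_eq m r
        rw [← Nat.cast_sub h]
        norm_cast
        rw [mul_comm, this]
      · simp [Nat.choose_eq_zero_of_lt h, Nat.choose_eq_zero_of_lt (Nat.lt_succ_of_lt h)]
    have h4 : ((a + 1 : ℕ) : ℚ) * (a + 1 + m).choose (a + 1) = (a + m).choose a * (a + m + 1) := by
      have := Nat.add_one_mul_choose_eq (a + m) a
      rw [add_right_comm] at this
      norm_cast
      rw [mul_comm, ← this, mul_comm]
      ring
    have h5 : (((a + 1 + m).choose (a + 1) : ℕ) : ℚ) =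
        (a + m).choose a + m.multichoose (a + 1) := by
      rw [Nat.multichoose_eq]
      norm_cast
      rw [add_right_comm, Nat.choose_succ_succ, show m + (a + 1) - 1 = a + m by omega]
    have h1' : (Module.finrank ℂ (diracKer (m + 1) a b (r + 1)) : ℚ) +
        Module.finrank ℂ (diracKer (m + 1) (a + 1) b r) =
        m.multichoose (a + 1) * m.multichoose b * m.choose r := by
      exact_mod_cast h1
    push_cast at h2 h4 ⊢
    linear_combination ((a : ℚ) + 1 + r) * h1' - h2 -
      ((a + m).choose a : ℚ) * (m.multichoose b : ℚ) * h3 +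
      (m.choose r : ℚ) * (m.multichoose b : ℚ) * h4 -
      ((a : ℚ) + 1 + r) * (m.choose r : ℚ) * (m.multichoose b : ℚ) * h5

end PolynomialComplex

section Realization

open MvPolynomial TensorProduct

/-- The point of `ℂ^m ⊕ ℂ^m` whose coordinates are those of `z` and their conjugates. -/
def evalZ {m : ℕ} (z : Fin m → ℂ) : Fin m ⊕ Fin m → ℂ :=
  Sum.elim z fun j => (starRingEnd ℂ) (z j)

theorem evalZ_add_smul {m : ℕ} (z v : Fin m → ℂ) (t : ℝ) :
    evalZ (z + t • v) = evalZ z + t • evalZ v := by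
  ext (j | j) <;> simp [evalZ]

/-- A polynomial in `z` and its conjugate vanishing on `ℂ^m` vanishes identically. -/
theorem eq_zero_of_eval_evalZ {m : ℕ} {f : ZPoly m} (h : ∀ z, eval (evalZ z) f = 0) : f = 0 := by
  let g : ZPoly m := bind₁ (Sum.elim
    (fun j => X (Sum.inl j) + C Complex.I * X (Sum.inr j))
    (fun j => X (Sum.inl j) - C Complex.I * X (Sum.inr j))) f
  have hg (w : Fin m ⊕ Fin m → ℂ) : eval w g = eval (Sum.elim
      (fun j => w (Sum.inl j) + Complex.I * w (Sum.inr j))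
      (fun j => w (Sum.inl j) - Complex.I * w (Sum.inr j))) f := by
    rw [← coe_aeval_eq_eval, ← coe_aeval_eq_eval, RingHom.coe_coe, RingHom.coe_coe, aeval_bind₁]
    congr 2
    ext (j | j) <;> simp
  have hg0 : g = 0 := by
    refine funext_set (fun _ => Set.range ((↑) : ℝ → ℂ))
      (fun _ => Set.infinite_range_of_injective Complex.ofReal_injective) ?_
    intro w hw
    choose u hu using fun i => hw i (Set.mem_univ i)
    rw [hg, map_zero, ← h fun j => u (Sum.inl j) + Complex.I * u (Sum.inr j)]
    congr 2
    ext (j | j) <;> simp [evalZ, ← hu, sub_eq_add_neg]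
  refine MvPolynomial.funext fun w => ?_
  have := hg (Sum.elim (fun j => (w (Sum.inl j) + w (Sum.inr j)) / 2)
    (fun j => (w (Sum.inl j) - w (Sum.inr j)) / (2 * Complex.I)))
  rw [hg0, map_zero] at this
  rw [map_zero, this]
  congr 2
  ext (j | j)
  · simp
    field_simp
    ring
  · simp
    field_simp
    ring

/-- The function `ℂ^m → ℂ_{2n}` defined by a Clifford-valued polynomial. -/
def realize (m n : ℕ) : (ZPoly m ⊗[ℂ] Cl n) →ₗ[ℂ] ((Fin m → ℂ) → Cl n) :=
  LinearMap.pi fun z => (TensorProduct.lid ℂ (Cl n)).toLinearMap ∘ₗ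
    (aeval (R := ℂ) (evalZ z)).toLinearMap.rTensor (Cl n)

@[simp]
theorem realize_tmul {m n : ℕ} (f : ZPoly m) (c : Cl n) (z : Fin m → ℂ) :
    realize m n (f ⊗ₜ c) z = eval (evalZ z) f • c := by
  simp [realize, aeval_eq_eval]

/-- Contraction of a Clifford-valued polynomial with a linear functional on `ℂ_{2n}`. -/
def contr (m : ℕ) {n : ℕ} (φ : Cl n →ₗ[ℂ] ℂ) : (ZPoly m ⊗[ℂ] Cl n) →ₗ[ℂ] ZPoly m :=
  (TensorProduct.rid ℂ (ZPoly m)).toLinearMap ∘ₗ φ.lTensor (ZPoly m)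

@[simp]
theorem contr_tmul {m n : ℕ} (φ : Cl n →ₗ[ℂ] ℂ) (f : ZPoly m) (c : Cl n) :
    contr m φ (f ⊗ₜ c) = φ c • f := by
  simp [contr]

theorem contr_map {m n : ℕ} (φ : Cl n →ₗ[ℂ] ℂ) (D : ZPoly m →ₗ[ℂ] ZPoly m)
    (x : ZPoly m ⊗[ℂ] Cl n) : contr m φ (D.rTensor (Cl n) x) = D (contr m φ x) := by
  induction x with
  | zero => simp
  | add x y hx hy => simp [hx, hy]
  | tmul f c => simp

theorem apply_realize {m n : ℕ} (φ : Cl n →ₗ[ℂ] ℂ) (x : ZPoly m ⊗[ℂ] Cl n) (z : Fin m → ℂ) :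
    φ (realize m n x z) = eval (evalZ z) (contr m φ x) := by
  induction x with
  | zero => simp
  | add x y hx hy => simp [hx, hy]
  | tmul f c => simp [smul_eval, mul_comm]

theorem eq_of_contr_eq {m n : ℕ} {x y : ZPoly m ⊗[ℂ] Cl n}
    (h : ∀ φ : Cl n →ₗ[ℂ] ℂ, contr m φ x = contr m φ y) : x = y := by
  let b := Module.Free.chooseBasis ℂ (Cl n)
  have hb (i) (x : ZPoly m ⊗[ℂ] Cl n) :
      TensorProduct.equivFinsuppOfBasisRight b x i = contr m (b.coord i) x := by
    induction x with
    | zero => simp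
    | add x y hx hy => simp [hx, hy]
    | tmul f c => simp
  refine (TensorProduct.equivFinsuppOfBasisRight b).injective (Finsupp.ext fun i => ?_)
  rw [hb, hb, h]

theorem realize_injective (m n : ℕ) : Function.Injective (realize m n) := by
  intro x y h
  refine eq_of_contr_eq fun φ => sub_eq_zero.1 (eq_zero_of_eval_evalZ fun z => ?_)
  rw [map_sub, ← apply_realize, ← apply_realize, h, sub_self]

theorem hasDerivAt_eval_add_smul {σ : Type*} [Fintype σ] (u w : σ → ℂ) (f : MvPolynomial σ ℂ) :
    HasDerivAt (fun t : ℝ => eval (u + t • w) f) (∑ i, w i * eval u (pderiv i f)) 0 := by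
  classical
  induction f using MvPolynomial.induction_on with
  | C c => simpa using hasDerivAt_const (0 : ℝ) c
  | add f g hf hg =>
    refine ((hf.add hg).congr_deriv ?_).congr_of_eventuallyEq
      (Filter.Eventually.of_forall fun t => ?_)
    · simp [mul_add, Finset.sum_add_distrib]
    · simp
  | mul_X f i hf =>
    have h1 : HasDerivAt (fun t : ℝ => u i + t • w i) (w i) 0 := by
      simpa using ((hasDerivAt_id (0 : ℝ)).smul_const (w i)).const_add (u i)
    have h2 := hf.mul h1
    refine (h2.congr_deriv ?_).congr_of_eventuallyEq (Filter.Eventually.of_forall fun t => ?_)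
    · simp [Derivation.leibniz, mul_add, Finset.sum_add_distrib, pderiv_X, Pi.single_apply,
        Finset.sum_mul, apply_ite]
      rw [add_comm]
      congr 1
      · ring
      · exact Finset.sum_congr rfl fun _ _ => by ring
    · simp

theorem hasDirDeriv_realize {m n : ℕ} (x : ZPoly m ⊗[ℂ] Cl n) (z v : Fin m → ℂ) :
    HasDirDeriv (realize m n x) z v (∑ i, evalZ v i •
      realize m n ((pderiv i).toLinearMap.rTensor (Cl n) x) z) := by
  intro φ
  simp_rw [apply_realize, map_sum, map_smul, apply_realize, contr_map, evalZ_add_smul]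
  exact hasDerivAt_eval_add_smul _ _ _

theorem HasDirDeriv.unique {n m : ℕ} {f : (Fin m → ℂ) → Cl n} {z v : Fin m → ℂ} {d d' : Cl n}
    (h : HasDirDeriv f z v d) (h' : HasDirDeriv f z v d') : d = d' := by
  rw [← sub_eq_zero, ← Module.forall_dual_apply_eq_zero_iff ℂ]
  intro φ
  rw [map_sub, (h φ).unique (h' φ), sub_self]

theorem HasDirDeriv.dirDeriv_eq {n m : ℕ} {f : (Fin m → ℂ) → Cl n} {z v : Fin m → ℂ} {d : Cl n}
    (h : HasDirDeriv f z v d) : dirDeriv f v z = d :=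
  HasDirDeriv.unique (Classical.epsilon_spec (p := fun d => HasDirDeriv f z v d) ⟨d, h⟩) h

theorem pz_realize {m n : ℕ} (j : Fin m) (x : ZPoly m ⊗[ℂ] Cl n) (z : Fin m → ℂ) :
    pz j (realize m n x) z = realize m n ((pderiv (Sum.inl j)).toLinearMap.rTensor (Cl n) x) z := by
  rw [pz, (hasDirDeriv_realize x z _).dirDeriv_eq, (hasDirDeriv_realize x z _).dirDeriv_eq]
  simp only [evalZ, Fintype.sum_sum_type, Sum.elim_inl, Sum.elim_inr, Pi.single_apply, apply_ite,
    map_one, map_zero, ite_smul, one_smul, zero_smul, Finset.sum_ite_eq', Finset.mem_univ, if_true,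
    Complex.conj_I, smul_add, smul_smul, neg_smul, Complex.I_mul_I]
  match_scalars
  all_goals ring_nf
  simp

theorem dzT_realize {n : ℕ} (x : ZPoly (n - 1) ⊗[ℂ] Cl n) (z : Fin (n - 1) → ℂ) :
    dzT n (realize (n - 1) n x) z = realize (n - 1) n (dirac n x) z := by
  simp_rw [dzT, pz_realize]
  induction x with
  | zero => simp
  | add x y hx hy => simp [mul_add, Finset.sum_add_distrib, hx, hy]
  | tmul f c => simp [dirac_tmul, map_sum, Finset.sum_apply]

theorem dzT_realize_eq_zero_iff {n : ℕ} {x : ZPoly (n - 1) ⊗[ℂ] Cl n} :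
    (∀ z, dzT n (realize (n - 1) n x) z = 0) ↔ x ∈ LinearMap.ker (dirac n) := by
  rw [LinearMap.mem_ker, ← map_eq_zero_iff _ (realize_injective (n - 1) n), funext_iff]
  simp_rw [dzT_realize]
  rfl

theorem IsPolyMap.add {n m : ℕ} {p q : (Fin m → ℂ) → Cl n} (hp : IsPolyMap n m p)
    (hq : IsPolyMap n m q) : IsPolyMap n m (p + q) := by
  obtain ⟨N, c, dx, dy, h⟩ := hp
  obtain ⟨N', c', dx', dy', h'⟩ := hq
  refine ⟨N + N', Fin.append c c', Fin.append dx dx', Fin.append dy dy', fun z => ?_⟩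
  simp [Fin.sum_univ_add, h, h']

theorem isPolyMap_realize {m n : ℕ} (x : ZPoly m ⊗[ℂ] Cl n) : IsPolyMap n m (realize m n x) := by
  induction x with
  | zero => exact ⟨0, Fin.elim0, Fin.elim0, Fin.elim0, fun z => by simp⟩
  | add x y hx hy => exact map_add (realize m n) x y ▸ hx.add hy
  | tmul f c =>
    induction f using MvPolynomial.induction_on' with
    | add f g hf hg =>
      rw [add_tmul, map_add]
      exact hf.add hg
    | monomial d k =>
      refine ⟨1, fun _ => k • c, fun _ j => d (Sum.inl j), fun _ j => d (Sum.inr j), fun z => ?_⟩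
      simp [eval_monomial, Finsupp.prod_fintype, Finset.prod_mul_distrib, evalZ, smul_smul,
        mul_comm]

theorem IsPolyMap.exists_realize_eq {n m : ℕ} {p : (Fin m → ℂ) → Cl n} (hp : IsPolyMap n m p) :
    ∃ x, realize m n x = p := by
  obtain ⟨N, c, dx, dy, h⟩ := hp
  refine ⟨∑ t, (∏ j, X (Sum.inl j) ^ dx t j * X (Sum.inr j) ^ dy t j) ⊗ₜ c t, ?_⟩
  ext1 z
  simp [h, map_sum, Finset.sum_apply, evalZ, map_prod]

theorem coeff_bind₁_C_mul_X {σ : Type*} [Fintype σ] (u : σ → ℂ) (f : MvPolynomial σ ℂ)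
    (d : σ →₀ ℕ) : coeff d (bind₁ (fun i => C (u i) * X i) f) = (∏ i, u i ^ d i) * coeff d f := by
  induction f using MvPolynomial.induction_on' with
  | add f g hf hg => simp [hf, hg, mul_add]
  | monomial d' k =>
    classical
    have : bind₁ (fun i => C (u i) * X i) (monomial d' k) =
        monomial d' (k * ∏ i, u i ^ d' i) := by
      rw [monomial_eq, monomial_eq, Finsupp.prod_fintype _ _ (by simp)]
      simp [mul_pow, Finset.prod_mul_distrib, map_prod, mul_assoc]
    rw [this, coeff_monomial, coeff_monomial]
    split_ifs with h
    · rw [h, mul_comm]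
    · rw [mul_zero]

theorem eval_evalZ_smul {m : ℕ} (c : ℂ) (z : Fin m → ℂ) (f : ZPoly m) :
    eval (evalZ (c • z)) f =
      eval (evalZ z) (bind₁ (fun i => C (evalZ (fun _ : Fin m => c) i) * X i) f) := by
  rw [← coe_aeval_eq_eval, ← coe_aeval_eq_eval, RingHom.coe_coe, RingHom.coe_coe, aeval_bind₁]
  congr 2
  ext (j | j) <;> simp [evalZ]

theorem prod_evalZ_const_pow {m : ℕ} (c : ℂ) (d : Fin m ⊕ Fin m →₀ ℕ) :
    ∏ i, evalZ (fun _ : Fin m => c) i ^ d i =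
      c ^ (∑ j, d (Sum.inl j)) * (starRingEnd ℂ) c ^ (∑ j, d (Sum.inr j)) := by
  simp [evalZ, Finset.prod_pow_eq_pow_sum]

theorem bidegree_unique {k l a b : ℕ}
    (h : ∀ c : ℂ, c ^ k * (starRingEnd ℂ) c ^ l = c ^ a * (starRingEnd ℂ) c ^ b) :
    k = a ∧ l = b := by
  have h1 : k + l = a + b := by
    have h2 := h 2
    rw [Complex.conj_ofNat, ← pow_add, ← pow_add] at h2
    exact Nat.pow_right_injective le_rfl (by exact_mod_cast h2)
  have h3 : (k : ℤ) - l = a - b := by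
    have h2 := h (Complex.exp Complex.I)
    rw [← Complex.exp_conj, ← Complex.exp_nat_mul, ← Complex.exp_nat_mul, ← Complex.exp_nat_mul,
      ← Complex.exp_nat_mul, ← Complex.exp_add, ← Complex.exp_add,
      Complex.exp_eq_exp_iff_exists_int, Complex.conj_I] at h2
    obtain ⟨N, hN⟩ := h2
    have h4 : ((k : ℂ) - l - (a - b)) = ((2 * N : ℤ) : ℂ) * Real.pi := by
      refine mul_right_cancel₀ Complex.I_ne_zero ?_
      push_cast
      linear_combination hN
    have h5 : (((k : ℤ) - l - (a - b) : ℤ) : ℝ) = ((2 * N : ℤ) : ℝ) * Real.pi := by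
      exact_mod_cast h4
    by_cases hN0 : 2 * N = 0
    · rw [hN0, Int.cast_zero, zero_mul, Int.cast_eq_zero, sub_eq_zero] at h5
      exact h5
    · exact absurd h5.symm ((irrational_pi.intCast_mul hN0).ne_int _)
  omega

theorem mem_biPoly_iff {m a b : ℕ} {f : ZPoly m} : f ∈ biPoly m a b ↔
    ∀ (c : ℂ) (z : Fin m → ℂ), eval (evalZ (c • z)) f =
      c ^ a * (starRingEnd ℂ) c ^ b * eval (evalZ z) f := by
  have h (c : ℂ) : (∀ z : Fin m → ℂ, eval (evalZ (c • z)) f =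
      c ^ a * (starRingEnd ℂ) c ^ b * eval (evalZ z) f) ↔ ∀ d,
        c ^ (∑ j, d (Sum.inl j)) * (starRingEnd ℂ) c ^ (∑ j, d (Sum.inr j)) * coeff d f =
          c ^ a * (starRingEnd ℂ) c ^ b * coeff d f := by
    simp_rw [eval_evalZ_smul, ← smul_eval, ← prod_evalZ_const_pow, ← coeff_bind₁_C_mul_X,
      ← smul_eq_mul (a := c ^ a * _), ← coeff_smul, ← MvPolynomial.ext_iff]
    refine ⟨fun h => sub_eq_zero.1 (eq_zero_of_eval_evalZ fun z => ?_), fun h z => by rw [h]⟩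
    rw [map_sub, h, sub_self]
  simp_rw [h, biPoly, mem_restrictSupport_iff, Set.subset_def, Finset.mem_coe, mem_support_iff]
  constructor
  · intro hf c d
    by_cases hd : coeff d f = 0
    · rw [hd, mul_zero, mul_zero]
    · rw [(hf d hd).1, (hf d hd).2]
  · exact fun hf d hd => bidegree_unique fun c => mul_right_cancel₀ hd (hf c d)

theorem realize_smul_eq_iff {m n a b : ℕ} {x : ZPoly m ⊗[ℂ] Cl n} :
    (∀ (c : ℂ) (z : Fin m → ℂ), realize m n x (c • z) =
      (c ^ a * (starRingEnd ℂ) c ^ b) • realize m n x z) ↔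
    ∀ φ : Cl n →ₗ[ℂ] ℂ, contr m φ x ∈ biPoly m a b := by
  simp_rw [mem_biPoly_iff, ← apply_realize]
  constructor
  · intro h φ c z
    rw [h, map_smul, smul_eq_mul]
  · intro h c z
    rw [← sub_eq_zero, ← Module.forall_dual_apply_eq_zero_iff ℂ]
    intro φ
    rw [map_sub, h, map_smul, smul_eq_mul, sub_self]

theorem mem_polySpace_iff {n a b r : ℕ} {x : ZPoly (n - 1) ⊗[ℂ] Cl n} :
    x ∈ polySpace n a b r ↔ IsBihom n (n - 1) a b (realize (n - 1) n x) ∧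
      ∀ z, realize (n - 1) n x z ∈ LamT n r := by
  rw [IsBihom, realize_smul_eq_iff, and_iff_right (isPolyMap_realize x)]
  constructor
  · intro hx
    refine ⟨fun φ => ?_, fun z => ?_⟩
    · refine (polySpace_le_iff (W := (biPoly (n - 1) a b).comap (contr (n - 1) φ))).2 ?_ hx
      intro f hf c _
      simpa using Submodule.smul_mem _ _ hf
    · refine (polySpace_le_iff (W := (LamT n r).comap
        (LinearMap.proj z ∘ₗ realize (n - 1) n))).2 ?_ hx
      intro f _ c hc
      simpa using Submodule.smul_mem _ _ hc
  · rintro ⟨hx, hx'⟩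
    obtain ⟨h, hh⟩ := (biPoly (n - 1) a b).subtype.exists_leftInverse_of_injective
      (Submodule.ker_subtype _)
    obtain ⟨π, hπ⟩ := (LamT n r).subtype.exists_leftInverse_of_injective
      (Submodule.ker_subtype _)
    have h1 : ((biPoly (n - 1) a b).subtype ∘ₗ h).rTensor (Cl n) x = x := by
      refine eq_of_contr_eq fun φ => ?_
      rw [contr_map]
      exact congrArg Subtype.val (LinearMap.congr_fun hh ⟨_, hx φ⟩)
    have h2 : ((LamT n r).subtype ∘ₗ π).lTensor (ZPoly (n - 1)) x = x := by
      refine realize_injective _ _ (_root_.funext fun z => ?_)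
      have h3 (y : ZPoly (n - 1) ⊗[ℂ] Cl n) : realize (n - 1) n
          (((LamT n r).subtype ∘ₗ π).lTensor (ZPoly (n - 1)) y) z =
            π (realize (n - 1) n y z) := by
        induction y with
        | zero => simp
        | add x y hx hy => simp [hx, hy]
        | tmul f c => simp
      rw [h3]
      exact congrArg Subtype.val (LinearMap.congr_fun hπ ⟨_, hx' z⟩)
    refine ⟨TensorProduct.map h π x, ?_⟩
    nth_rewrite 2 [← h2]
    nth_rewrite 2 [← h1]
    rw [TensorProduct.mapIncl, ← LinearMap.comp_apply, ← TensorProduct.map_comp,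
      ← LinearMap.comp_apply, LinearMap.lTensor_comp_rTensor]

theorem exists_linearIndependent_span_image {K V W : Type*} [Field K] [AddCommGroup V] [Module K V]
    [AddCommGroup W] [Module K W] (U : Submodule K V) [FiniteDimensional K U] (L : V →ₗ[K] W)
    (hL : Function.Injective L) : ∃ g : Fin (Module.finrank K U) → W,
      (∀ t, ∃ x ∈ U, L x = g t) ∧ LinearIndependent K g ∧
        ∀ x ∈ U, L x ∈ Submodule.span K (Set.range g) := by
  let B := Module.finBasis K U
  have hL' : Function.Injective (L ∘ₗ U.subtype) := hL.comp Subtype.val_injective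
  refine ⟨(L ∘ₗ U.subtype) ∘ B, fun t => ⟨B t, (B t).2, rfl⟩,
    B.linearIndependent.map' _ (LinearMap.ker_eq_bot.2 hL'), fun x hx => ?_⟩
  rw [Set.range_comp, ← Submodule.map_span, B.span_eq]
  exact ⟨⟨x, hx⟩, trivial, rfl⟩

theorem mem_diracKer_iff {n a b r : ℕ} {x : ZPoly (n - 1) ⊗[ℂ] Cl n} :
    x ∈ diracKer n a b r ↔ IsBihom n (n - 1) a b (realize (n - 1) n x) ∧
      (∀ z, realize (n - 1) n x z ∈ LamT n r) ∧ ∀ z, dzT n (realize (n - 1) n x) z = 0 := by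
  rw [diracKer, Submodule.mem_inf, mem_polySpace_iff, dzT_realize_eq_zero_iff, and_assoc]

end Realization

/-- **Dimension of `𝒳_{a,b,r} = Ker ∂_z̃ ∩ 𝒫_{a,b,r}`:** the space of bidegree-`(a,b)`
homogeneous polynomials `ℂ^{n-1} → (∧_{n-1}†)^{(r)} I` killed by `∂_z̃` has dimension
`x_{a,b,r} = (r/(a+r)) C(n-1,r) C(a+n-1,a) C(b+n-2,b)`, witnessed by a spanning linearly
independent family of that cardinality. -/
theorem dim_ker_dzT (n : ℕ) (hn : 2 ≤ n) (a b r : ℕ) (hr1 : 1 ≤ r) (hrn : r ≤ n - 1) :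
    ∃ d : ℕ,
      (d : ℚ) = (r : ℚ) / ((a : ℚ) + r) * (Nat.choose (n - 1) r : ℚ) *
        (Nat.choose (a + n - 1) a : ℚ) * (Nat.choose (b + n - 2) b : ℚ) ∧
      ∃ g : Fin d → ((Fin (n - 1) → ℂ) → Cl n),
        (∀ t, IsBihom n (n - 1) a b (g t) ∧ (∀ z, g t z ∈ LamT n r) ∧
          (∀ z, dzT n (g t) z = 0)) ∧
        LinearIndependent ℂ g ∧
        ∀ p : (Fin (n - 1) → ℂ) → Cl n,
          (IsBihom n (n - 1) a b p ∧ (∀ z, p z ∈ LamT n r) ∧ (∀ z, dzT n p z = 0)) →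
            p ∈ Submodule.span ℂ (Set.range g) := by

  refine ⟨Module.finrank ℂ (diracKer n a b r), ?_, ?_⟩
  · obtain ⟨m, rfl⟩ : ∃ m, n = m + 1 := ⟨n - 1, by omega⟩
    have h := finrank_diracKer m a b r hr1
    rw [Nat.multichoose_eq] at h
    have h0 : (a : ℚ) + r ≠ 0 := by positivity
    rw [show a + (m + 1) - 1 = a + m by omega, show b + (m + 1) - 2 = m + b - 1 by omega]
    change _ = _ * (m.choose r : ℚ) * _ * _
    field_simp
    linear_combination h
  · obtain ⟨g, hg, hli, hspan⟩ := exists_linearIndependent_span_image (K := ℂ)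
      (V := TensorProduct ℂ (ZPoly (n - 1)) (Cl n)) (diracKer n a b r) (realize (n - 1) n)
      (realize_injective (n - 1) n)
    refine ⟨g, fun t => ?_, hli, fun p hp => ?_⟩
    · obtain ⟨x, hx, hxt⟩ := hg t
      exact hxt ▸ mem_diracKer_iff.1 hx
    · obtain ⟨x, rfl⟩ := hp.1.1.exists_realize_eq
      exact hspan x (mem_diracKer_iff.2 hp)
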